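/- Let G(V,E,f⁰) be a graph with flags and let e be a bridge of G. Then 𝒯_{G/e}(x,y,t) = 𝒯_{G−e}(x,y,t) = t^{−2} 𝒯_{G∨e}(x,y,t), and 𝒯_G(x,y,t) = (1 + (x−1)t²) · 𝒯_{G/e}(x,y,t). -/

import Mathlib

/-!
# Statement 2

A graph with flags is modelled by finite vertex and edge sets, an incidence map
sending each edge to its (ordered pair of) end vertices, and the number
`flags = |f⁰|` of additional flags.  A spanning c-subgraph is determined by its
edge set `A`; it has all vertices, all flags of `f⁰`, plus two flags for each
cut edge of `E ∖ A`, so its number of flags is `|f⁰| + 2(|E| - |A|)`.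
-/

/-- A graph with flags `G(V, E, f⁰)`: finite vertex and edge sets, each edge
incident to one or two end vertices (recorded as an ordered pair; a self-loop
has both components equal), together with a number `flags = |f⁰|` of
additional flags (half-edges attached to vertices). -/
structure FlagGraph where
  V : Type
  E : Type
  vFin : Fintype V
  eFin : Fintype E
  eDec : DecidableEq E
  ends : E → V × V
  flags : ℕ

attribute [instance] FlagGraph.vFin FlagGraph.eFin FlagGraph.eDec

namespace FlagGraph

variable (G : FlagGraph)

/-- `u` and `v` are joined by some edge of the spanning c-subgraph with edge set `A`. -/
def adj (A : Finset G.E) (u v : G.V) : Prop :=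
  ∃ e ∈ A, G.ends e = (u, v) ∨ G.ends e = (v, u)

/-- `k(A)`: the number of connected components of the spanning c-subgraph with
edge set `A` (it has all the vertices of `G`). -/
noncomputable def kc (A : Finset G.E) : ℕ :=
  Nat.card (Quot (G.adj A))

/-- `r(G) - r(A) = k(A) - k(G)`, where `r(A) = |V| - k(A)` is the rank. -/
noncomputable def corank (A : Finset G.E) : ℕ :=
  G.kc A - G.kc Finset.univ

/-- The nullity `n(A) = |E_A| + k(A) - |V|`. -/
noncomputable def nullity (A : Finset G.E) : ℕ :=
  A.card + G.kc A - Fintype.card G.V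

/-- `f(A)`: the number of flags of the spanning c-subgraph `A`, namely the
flags of `f⁰` together with the two flags obtained by cutting each edge not
in `A`. -/
def nflags (A : Finset G.E) : ℕ :=
  G.flags + 2 * (Fintype.card G.E - A.card)

/-- The Tutte polynomial of a graph with flags,
`𝒯_G(x,y,t) = Σ_{A ⋐ G} (x-1)^{r(G)-r(A)} (y-1)^{n(A)} t^{f(A)}`. -/
noncomputable def T {K : Type*} [CommRing K] (x y t : K) : K :=
  ∑ A : Finset G.E,
    (x - 1) ^ G.corank A * (y - 1) ^ G.nullity A * t ^ G.nflags A

/-- A self-loop: both ends of `e` are incident to the same vertex. -/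
def IsSelfLoop (e : G.E) : Prop := (G.ends e).1 = (G.ends e).2

/-- A bridge: removing `e` disconnects a component. -/
def IsBridge (e : G.E) : Prop :=
  G.kc (Finset.univ.erase e) = G.kc Finset.univ + 1

/-- A regular (ordinary) edge: neither a bridge nor a self-loop. -/
def IsRegular (e : G.E) : Prop := ¬ G.IsSelfLoop e ∧ ¬ G.IsBridge e

/-- The graph `G − e` obtained by deleting the edge `e`. -/
def del (e : G.E) : FlagGraph where
  V := G.V
  E := {e' : G.E // e' ≠ e}
  vFin := G.vFin
  eFin := by infer_instance
  eDec := by infer_instance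
  ends := fun e' => G.ends e'.1
  flags := G.flags

/-- The graph `G ∨ e` obtained by cutting the edge `e`: `e` is removed and two
flags are attached at its former end vertices. -/
def cut (e : G.E) : FlagGraph where
  V := G.V
  E := {e' : G.E // e' ≠ e}
  vFin := G.vFin
  eFin := by infer_instance
  eDec := by infer_instance
  ends := fun e' => G.ends e'.1
  flags := G.flags + 2

/-- The relation identifying the two end vertices of `e`. -/
def contractRel (e : G.E) (u v : G.V) : Prop :=
  u = (G.ends e).1 ∧ v = (G.ends e).2

open scoped Classical in
/-- The graph `G/e` obtained by contracting the edge `e`: for a non-self-loop,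
`e` is removed and its end vertices are identified into a single vertex
carrying all their remaining edges and flags; for a self-loop, `G/e := G − e`. -/
noncomputable def contract (e : G.E) : FlagGraph :=
  if G.IsSelfLoop e then G.del e
  else
    { V := Quot (G.contractRel e)
      E := {e' : G.E // e' ≠ e}
      vFin := @Fintype.ofFinite _
        (Finite.of_surjective (Quot.mk (G.contractRel e))
          (fun q => Quot.inductionOn q fun v => ⟨v, rfl⟩))
      eFin := by infer_instance
      eDec := by infer_instance
      ends := fun e' =>
        (Quot.mk (G.contractRel e) (G.ends e'.1).1,
         Quot.mk (G.contractRel e) (G.ends e'.1).2)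
      flags := G.flags }

end FlagGraph

/-- A quotient of a quotient is a quotient by any relation generating the same identifications. -/
theorem card_quot_quot {α : Type*} {r t : α → α → Prop} {s : Quot r → Quot r → Prop}
    (hr : ∀ u v, r u v → Quot.mk t u = Quot.mk t v)
    (hs : ∀ u v, s (Quot.mk r u) (Quot.mk r v) → Quot.mk t u = Quot.mk t v)
    (ht : ∀ u v, t u v → Quot.mk s (Quot.mk r u) = Quot.mk s (Quot.mk r v)) :
    Nat.card (Quot s) = Nat.card (Quot t) :=
  Nat.card_congr
    { toFun := Quot.lift (Quot.lift (Quot.mk t) hr) (by rintro ⟨u⟩ ⟨v⟩ h; exact hs u v h)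
      invFun := Quot.lift (fun u => Quot.mk s (Quot.mk r u)) ht
      left_inv := by rintro ⟨⟨u⟩⟩; rfl
      right_inv := by rintro ⟨u⟩; rfl }

/-- Identifying two distinct points of a finite type removes exactly one point. -/
theorem card_quot_pair {α : Type*} [Finite α] {a b : α} (hab : a ≠ b) :
    Nat.card (Quot fun u v => u = a ∧ v = b) + 1 = Nat.card α := by
  classical
  have := Fintype.ofFinite α
  have h : Nat.card (Quot fun u v => u = a ∧ v = b) = Nat.card {v // v ≠ b} :=
    Nat.card_congr
      { toFun := Quot.lift (fun v => if h : v = b then ⟨a, hab⟩ else ⟨v, h⟩) (by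
          rintro u v ⟨rfl, rfl⟩
          simp [hab])
        invFun := fun v => Quot.mk _ v.1
        left_inv := by
          rintro ⟨v⟩
          by_cases h : v = b
          · subst h
            simpa using Quot.sound ⟨rfl, rfl⟩
          · simp [h]
        right_inv := by
          rintro ⟨v, h⟩
          simp [h] }
  have hpos : 0 < Fintype.card α := Fintype.card_pos_iff.mpr ⟨a⟩
  rw [h, Nat.card_eq_fintype_card, Nat.card_eq_fintype_card, Fintype.card_subtype_compl,
    Fintype.card_subtype_eq]
  omega

/-- Identifying a point with itself changes nothing. -/
theorem card_quot_pair_self {α : Type*} (a : α) :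
    Nat.card (Quot fun u v => u = a ∧ v = a) = Nat.card α :=
  Nat.card_congr
    { toFun := Quot.lift id (by rintro u v ⟨rfl, rfl⟩; rfl)
      invFun := Quot.mk _
      left_inv := by rintro ⟨u⟩; rfl
      right_inv := fun _ => rfl }

namespace FlagGraph

variable {G : FlagGraph} {e : G.E}

theorem adj_mono {A B : Finset G.E} (h : A ⊆ B) {u v : G.V} (huv : G.adj A u v) :
    G.adj B u v := by
  obtain ⟨f, hf, hfe⟩ := huv
  exact ⟨f, h hf, hfe⟩

theorem mk_adj_mono {A B : Finset G.E} (h : A ⊆ B) {u v : G.V}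
    (huv : Quot.mk (G.adj A) u = Quot.mk (G.adj A) v) :
    Quot.mk (G.adj B) u = Quot.mk (G.adj B) v :=
  congrArg (Quot.map id fun _ _ => adj_mono h) huv

theorem mk_adj_ends {A : Finset G.E} {f : G.E} (hf : f ∈ A) :
    Quot.mk (G.adj A) (G.ends f).1 = Quot.mk (G.adj A) (G.ends f).2 :=
  Quot.sound ⟨f, hf, Or.inl rfl⟩

theorem kc_anti {A B : Finset G.E} (h : A ⊆ B) : G.kc B ≤ G.kc A :=
  Nat.card_le_card_of_surjective (Quot.map id fun _ _ => adj_mono h)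
    (by rintro ⟨u⟩; exact ⟨Quot.mk _ u, rfl⟩)

theorem kc_insert (A : Finset G.E) :
    G.kc (insert e A) = Nat.card (Quot fun p q : Quot (G.adj A) =>
      p = Quot.mk _ (G.ends e).1 ∧ q = Quot.mk _ (G.ends e).2) := by
  have hsub := Finset.subset_insert e A
  symm
  apply card_quot_quot
  · exact fun u v h => Quot.sound (adj_mono hsub h)
  · rintro u v ⟨hu, hv⟩
    rw [mk_adj_mono hsub hu, mk_adj_mono hsub hv]
    exact mk_adj_ends (Finset.mem_insert_self e A)
  · rintro u v ⟨f, hf, hfe⟩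
    rcases Finset.mem_insert.mp hf with rfl | hf
    · rcases hfe with hfe | hfe
      · exact Quot.sound (by simp [hfe])
      · exact (Quot.sound (by simp [hfe])).symm
    · exact congrArg _ (Quot.sound ⟨f, hf, hfe⟩)

theorem IsBridge.mk_ends_ne (he : G.IsBridge e) {A : Finset G.E} (hA : e ∉ A) :
    Quot.mk (G.adj A) (G.ends e).1 ≠ Quot.mk (G.adj A) (G.ends e).2 := by
  intro h
  have hk := kc_insert (e := e) (Finset.univ.erase e)
  rw [mk_adj_mono (Finset.subset_erase.mpr ⟨Finset.subset_univ A, hA⟩) h,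
    card_quot_pair_self, Finset.insert_erase (Finset.mem_univ e)] at hk
  have hb : G.kc (Finset.univ.erase e) = G.kc Finset.univ + 1 := he
  rw [hk] at hb
  exact absurd hb (Nat.succ_ne_self _).symm

theorem IsBridge.not_isSelfLoop (he : G.IsBridge e) : ¬ G.IsSelfLoop e := fun h =>
  he.mk_ends_ne (Finset.notMem_empty e) (congrArg _ h)

theorem IsBridge.kc_insert_add_one (he : G.IsBridge e) {A : Finset G.E} (hA : e ∉ A) :
    G.kc (insert e A) + 1 = G.kc A := by
  rw [kc_insert]
  exact card_quot_pair (he.mk_ends_ne hA)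

/-- The edge set of `G` corresponding to a set of edges other than `e`. -/
def liftEdges (A : Finset {f : G.E // f ≠ e}) : Finset G.E :=
  A.map (Function.Embedding.subtype _)

theorem notMem_liftEdges (A : Finset {f : G.E // f ≠ e}) : e ∉ liftEdges A := by
  simp [liftEdges]

theorem card_liftEdges (A : Finset {f : G.E // f ≠ e}) : (liftEdges A).card = A.card :=
  Finset.card_map _

theorem liftEdges_univ :
    liftEdges (Finset.univ : Finset {f : G.E // f ≠ e}) = Finset.univ.erase e := by
  ext f
  simp [liftEdges]

theorem card_edges_ne : Fintype.card {f : G.E // f ≠ e} + 1 = Fintype.card G.E := by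
  have hpos : 0 < Fintype.card G.E := Fintype.card_pos_iff.mpr ⟨e⟩
  rw [Fintype.card_subtype_compl, Fintype.card_subtype_eq]
  omega

theorem sum_edges {M : Type*} [AddCommMonoid M] (F : Finset G.E → M) :
    ∑ A, F A = ∑ A : Finset {f : G.E // f ≠ e}, (F (liftEdges A) + F (insert e (liftEdges A))) := by
  have h : ∀ F : Finset G.E → M, ∑ A ∈ (Finset.univ.erase e).powerset, F A =
      ∑ A : Finset {f : G.E // f ≠ e}, F (liftEdges A) := by
    intro F
    symm
    apply Finset.sum_nbij liftEdges
    · intro A _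
      exact Finset.mem_powerset.mpr
        (Finset.subset_erase.mpr ⟨Finset.subset_univ _, notMem_liftEdges A⟩)
    · exact fun A _ B _ hAB => Finset.map_injective _ hAB
    · intro A hA
      have hA : e ∉ A := (Finset.subset_erase.mp (Finset.mem_powerset.mp hA)).2
      refine ⟨A.subtype _, Finset.mem_coe.mpr (Finset.mem_univ _), ?_⟩
      rw [liftEdges, Finset.subtype_map]
      exact Finset.filter_true_of_mem fun f hf hfe => hA (hfe ▸ hf)
    · exact fun _ _ => rfl
  rw [Finset.sum_add_distrib, ← h F, ← h fun A => F (insert e A),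
    ← Finset.sum_powerset_insert (Finset.notMem_erase e _),
    Finset.insert_erase (Finset.mem_univ e), Finset.powerset_univ]

theorem kc_del (A : Finset {f : G.E // f ≠ e}) :
    (G.del e).kc A = G.kc (liftEdges A) := by
  have h : (G.del e).adj A = G.adj (liftEdges A) := by
    funext u v
    simp [adj, del, liftEdges]
    rfl
  exact congrArg (fun r : G.V → G.V → Prop => Nat.card (Quot r)) h

/-- The contraction of `G` along an edge `e`, without the convention for self-loops. -/
noncomputable def contractEdge (G : FlagGraph) (e : G.E) : FlagGraph where
  V := Quot (G.contractRel e)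
  E := {e' : G.E // e' ≠ e}
  vFin := @Fintype.ofFinite _
    (Finite.of_surjective (Quot.mk (G.contractRel e))
      (fun q => Quot.inductionOn q fun v => ⟨v, rfl⟩))
  eFin := by infer_instance
  eDec := by infer_instance
  ends := fun e' =>
    (Quot.mk (G.contractRel e) (G.ends e'.1).1,
     Quot.mk (G.contractRel e) (G.ends e'.1).2)
  flags := G.flags

theorem contract_eq_contractEdge (h : ¬ G.IsSelfLoop e) : G.contract e = G.contractEdge e :=
  if_neg h

theorem card_contractEdge (h : ¬ G.IsSelfLoop e) :
    Fintype.card (G.contractEdge e).V + 1 = Fintype.card G.V := by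
  rw [← Nat.card_eq_fintype_card, ← Nat.card_eq_fintype_card]
  exact card_quot_pair h

theorem kc_contractEdge (A : Finset {f : G.E // f ≠ e}) :
    (G.contractEdge e).kc A = G.kc (insert e (liftEdges A)) := by
  have hrel : ∀ u v, G.contractRel e u v →
      Quot.mk (G.adj (insert e (liftEdges A))) u = Quot.mk _ v := by
    rintro u v ⟨rfl, rfl⟩
    exact mk_adj_ends (Finset.mem_insert_self e _)
  refine card_quot_quot (r := G.contractRel e) (s := (G.contractEdge e).adj A) hrel ?_ ?_
  · have key : ∀ f ∈ A, ∀ u v, (G.contractEdge e).ends f = (Quot.mk _ u, Quot.mk _ v) →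
        Quot.mk (G.adj (insert e (liftEdges A))) u = Quot.mk _ v := by
      intro f hf u v hfe
      have h1 := congrArg (fun p => Quot.lift _ hrel p.1) hfe
      have h2 := congrArg (fun p => Quot.lift _ hrel p.2) hfe
      exact h1.symm.trans ((mk_adj_ends (Finset.mem_insert_of_mem
        (Finset.mem_map_of_mem (Function.Embedding.subtype _) hf))).trans h2)
    rintro u v ⟨f, hf, hfe | hfe⟩
    · exact key f hf u v hfe
    · exact (key f hf v u hfe).symm
  · rintro u v ⟨f, hf, hfe⟩
    rcases Finset.mem_insert.mp hf with rfl | hf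
    · rcases hfe with hfe | hfe
      · exact congrArg _ (Quot.sound (by simp [contractRel, hfe]))
      · exact congrArg _ (Quot.sound (by simp [contractRel, hfe])).symm
    · obtain ⟨f, hfA, rfl⟩ := Finset.mem_map.mp hf
      refine Quot.sound ⟨f, hfA, ?_⟩
      rcases hfe with hfe | hfe
      · exact Or.inl (congrArg (fun p : G.V × G.V =>
          (Quot.mk (G.contractRel e) p.1, Quot.mk (G.contractRel e) p.2)) hfe)
      · exact Or.inr (congrArg (fun p : G.V × G.V =>
          (Quot.mk (G.contractRel e) p.1, Quot.mk (G.contractRel e) p.2)) hfe)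

theorem nflags_del (A : Finset {f : G.E // f ≠ e}) :
    (G.del e).nflags A = G.nflags (insert e (liftEdges A)) := by
  have hE := card_edges_ne (e := e)
  have hc := Finset.card_insert_of_notMem (notMem_liftEdges A)
  rw [card_liftEdges] at hc
  change G.flags + 2 * (Fintype.card {f : G.E // f ≠ e} - A.card) =
    G.flags + 2 * (Fintype.card G.E - (insert e (liftEdges A)).card)
  omega

theorem nflags_liftEdges (A : Finset {f : G.E // f ≠ e}) :
    G.nflags (liftEdges A) = (G.del e).nflags A + 2 := by
  have hE := card_edges_ne (e := e)
  have hA := Finset.card_le_univ A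
  change G.flags + 2 * (Fintype.card G.E - (liftEdges A).card) =
    G.flags + 2 * (Fintype.card {f : G.E // f ≠ e} - A.card) + 2
  rw [card_liftEdges]
  omega

theorem nullity_del (A : Finset {f : G.E // f ≠ e}) :
    (G.del e).nullity A = G.nullity (liftEdges A) := by
  have hk := kc_del A
  change A.card + (G.del e).kc A - Fintype.card G.V =
    (liftEdges A).card + G.kc (liftEdges A) - Fintype.card G.V
  rw [card_liftEdges, hk]

theorem IsBridge.nullity_insert (he : G.IsBridge e) {A : Finset G.E} (hA : e ∉ A) :
    G.nullity (insert e A) = G.nullity A := by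
  have hk := he.kc_insert_add_one hA
  have hc := Finset.card_insert_of_notMem hA
  unfold nullity
  omega

theorem IsBridge.corank_insert (he : G.IsBridge e) {A : Finset G.E} (hA : e ∉ A) :
    G.corank (insert e A) + 1 = G.corank A := by
  have hk := he.kc_insert_add_one hA
  have hu := kc_anti (Finset.subset_univ (insert e A))
  unfold corank
  omega

theorem IsBridge.corank_del (he : G.IsBridge e) (A : Finset {f : G.E // f ≠ e}) :
    (G.del e).corank A = G.corank (insert e (liftEdges A)) := by
  have hk := he.kc_insert_add_one (notMem_liftEdges A)
  have hb : G.kc (Finset.univ.erase e) = G.kc Finset.univ + 1 := he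
  have hu : (G.del e).kc Finset.univ = _ := kc_del Finset.univ
  have hA := kc_del A
  rw [liftEdges_univ] at hu
  unfold corank
  omega

variable {K : Type*} [CommRing K] (x y t : K)

theorem IsBridge.T_contract (he : G.IsBridge e) :
    (G.contract e).T x y t = (G.del e).T x y t := by
  rw [contract_eq_contractEdge he.not_isSelfLoop]
  refine Finset.sum_congr rfl fun A _ => ?_
  have hV := card_contractEdge he.not_isSelfLoop
  have hk := he.kc_insert_add_one (notMem_liftEdges A)
  have hkA := kc_contractEdge A
  have hku : (G.contractEdge e).kc Finset.univ = _ := kc_contractEdge Finset.univ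
  rw [liftEdges_univ, Finset.insert_erase (Finset.mem_univ e)] at hku
  have hcorank : (G.contractEdge e).corank A = (G.del e).corank A := by
    refine Eq.trans ?_ (he.corank_del A).symm
    unfold corank
    omega
  have hnullity : (G.contractEdge e).nullity A = (G.del e).nullity A := by
    refine Eq.trans ?_ (nullity_del A).symm
    have hc : (liftEdges A).card = A.card := card_liftEdges A
    have hn : (G.contractEdge e).nullity A =
      A.card + (G.contractEdge e).kc A - Fintype.card (G.contractEdge e).V := rfl
    rw [hn]
    unfold nullity
    omega
  exact congrArg₂ _ (congrArg₂ _ (congrArg _ hcorank) (congrArg _ hnullity)) rfl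

theorem T_cut : (G.cut e).T x y t = t ^ 2 * (G.del e).T x y t := by
  unfold T
  rw [Finset.mul_sum]
  refine Finset.sum_congr rfl fun A _ => ?_
  have hf : (G.cut e).nflags A = (G.del e).nflags A + 2 := Nat.add_right_comm _ _ _
  have hc : (G.cut e).corank A = (G.del e).corank A := rfl
  have hn : (G.cut e).nullity A = (G.del e).nullity A := rfl
  rw [hf, hc, hn]
  ring

theorem IsBridge.T_eq (he : G.IsBridge e) :
    G.T x y t = (1 + (x - 1) * t ^ 2) * (G.del e).T x y t := by
  unfold T
  rw [Finset.mul_sum, sum_edges (e := e)]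
  refine Finset.sum_congr rfl fun A _ => ?_
  have hA := notMem_liftEdges A
  rw [← he.corank_insert hA, he.nullity_insert hA, nflags_liftEdges, ← nflags_del,
    ← he.corank_del, ← nullity_del]
  ring

end FlagGraph

/-- For a bridge `e` of a graph with flags `G`,
`𝒯_{G/e} = 𝒯_{G−e} = t^{-2} 𝒯_{G∨e}`, and
`𝒯_G = (1 + (x-1)t²) ⬝ 𝒯_{G/e}`. -/
theorem tutte_flags_bridge
    {K : Type*} [Field K] (x y t : K) (ht : t ≠ 0)
    (G : FlagGraph) (e : G.E) (he : G.IsBridge e) :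
    (G.contract e).T x y t = (G.del e).T x y t ∧
    (G.del e).T x y t = t ^ (-2 : ℤ) * (G.cut e).T x y t ∧
    G.T x y t = (1 + (x - 1) * t ^ 2) * (G.contract e).T x y t := by
  refine ⟨he.T_contract x y t, ?_, ?_⟩
  · rw [FlagGraph.T_cut, zpow_neg, zpow_ofNat, inv_mul_cancel_left₀ (pow_ne_zero 2 ht)]
  · rw [he.T_contract, he.T_eq]
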